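/- Let T ∈ ℚ⟦z⟧ be the formal power series T = ∑_{k≥1} k^{k-1} z^k/k!, and let (G_n)_{n≥1} be the sequence of polynomials in ℚ[x] defined by G₁(x) = 1 and G_{n+1}(x) = (2n+nx)·G_n(x) + (1+x)²·G_n′(x). Then for every n ≥ 1, the n-th formal derivative of T equals exp(n·T) · (1−T)^{−n} · G_n(T/(1−T)), where exp(n·T) = ∑_{k≥0} (nT)^k/k!, (1−T) is invertible since it has constant term 1, and G_n(T/(1−T)) denotes the evaluation of the polynomial G_n at the power series T/(1−T). -/

import Mathlib

open PowerSeries Polynomial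

/-- The tree function `T = ∑_{k≥1} k^{k-1} z^k / k!` as a formal power series over `ℚ`. -/
noncomputable def treeT : PowerSeries ℚ :=
  PowerSeries.mk fun k => if k = 0 then 0 else (k : ℚ) ^ (k - 1) / (Nat.factorial k)

/-- The exponential `exp(S) = ∑_{k≥0} S^k / k!` of a power series `S` with zero
constant term: the coefficient of `z^d` only involves `S^k` for `k ≤ d`. -/
noncomputable def expPS (S : PowerSeries ℚ) : PowerSeries ℚ :=
  PowerSeries.mk fun d => ∑ k ∈ Finset.range (d + 1),
    (PowerSeries.coeff d (S ^ k)) / (Nat.factorial k)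

/-- Abel's identity (with `x = 1`) as a polynomial identity. -/
theorem abel_poly (n : ℕ) :
    ∑ k ∈ Finset.range (n + 1),
      Polynomial.C ((n.choose k : ℚ) * ((k : ℚ) + 1) ^ (k - 1)) *
        (Polynomial.X - Polynomial.C (k : ℚ)) ^ (n - k)
      = (Polynomial.X + 1 : Polynomial ℚ) ^ n := by
  induction n with
  | zero => simp
  | succ n ih =>
    rw [← sub_eq_zero]
    set p : Polynomial ℚ := ∑ k ∈ Finset.range (n + 1 + 1),
      Polynomial.C (((n + 1).choose k : ℚ) * ((k : ℚ) + 1) ^ (k - 1)) *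
        (Polynomial.X - Polynomial.C (k : ℚ)) ^ (n + 1 - k) with hp
    have hd : Polynomial.derivative (p - (Polynomial.X + 1) ^ (n + 1)) = 0 := by
      have h1 : Polynomial.derivative p = Polynomial.C ((n : ℚ) + 1) * (Polynomial.X + 1) ^ n := by
        rw [hp, Finset.sum_range_succ, Polynomial.derivative_add, Polynomial.derivative_sum, ← ih,
          Finset.mul_sum]
        simp only [Nat.sub_self, pow_zero, mul_one, Polynomial.derivative_C, add_zero]
        refine Finset.sum_congr rfl fun k hk => ?_
        have hk' : k ≤ n := Nat.lt_succ_iff.mp (Finset.mem_range.mp hk)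
        have e : n + 1 - k = (n - k) + 1 := by omega
        have hc : ((n + 1).choose k : ℚ) * ((n - k : ℕ) + 1) = (n + 1) * n.choose k := by
          have := Nat.choose_mul_succ_eq n k
          rw [e] at this
          have h2 : ((n.choose k * (n + 1) : ℕ) : ℚ) = (((n + 1).choose k * (n - k + 1) : ℕ) : ℚ) := by
            rw [this]
          rw [Nat.cast_mul, Nat.cast_mul, Nat.cast_add, Nat.cast_add, Nat.cast_one] at h2
          linarith
        rw [Polynomial.derivative_C_mul, e, Polynomial.derivative_X_sub_C_pow]
        simp only [Nat.add_sub_cancel, ← mul_assoc]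
        congr 1
        rw [← Polynomial.C_mul, ← Polynomial.C_mul]
        congr 1
        push_cast
        linear_combination ((k : ℚ) + 1) ^ (k - 1) * hc
      rw [Polynomial.derivative_sub, h1]
      simp [Polynomial.derivative_pow]
    have he : Polynomial.eval (-1) (p - (Polynomial.X + 1) ^ (n + 1)) = 0 := by
      have h0 := congrFun (fwdDiff_iter_pow_eq_zero_of_lt (R := ℚ) (Nat.lt_succ_self n)) 1
      rw [fwdDiff_iter_eq_sum_shift] at h0
      simp only [hp, Polynomial.eval_sub, Polynomial.eval_finsetSum, Polynomial.eval_mul,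
        Polynomial.eval_C, Polynomial.eval_pow, Polynomial.eval_X, Polynomial.eval_add,
        Polynomial.eval_one]
      simp only [neg_add_cancel, ne_eq, Nat.succ_ne_zero, not_false_eq_true, zero_pow, sub_zero]
      rw [Pi.zero_apply] at h0
      rw [← h0]
      refine Finset.sum_congr rfl fun k hk => ?_
      have hk' : k ≤ n + 1 := Nat.lt_succ_iff.mp (Finset.mem_range.mp hk)
      have e1 : (-1 - (k : ℚ)) = (-1) * ((k : ℚ) + 1) := by ring
      rw [e1, mul_pow]
      simp only [zsmul_eq_mul, nsmul_eq_mul, mul_one]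
      push_cast
      rcases Nat.eq_zero_or_pos k with rfl | hpos
      · simp
      · obtain ⟨m, rfl⟩ : ∃ m, n = (k - 1) + m := ⟨n - (k - 1), by omega⟩
        have e2 : k - 1 + m + 1 - k = m := by omega
        rw [e2, pow_add, add_comm (1 : ℚ)]
        ring
    have hC := Polynomial.eq_C_of_derivative_eq_zero hd
    rw [hC, Polynomial.eval_C] at he
    rw [hC, he, Polynomial.C_0]

/-- The series `T / z`. -/
noncomputable def treeE : PowerSeries ℚ :=
  PowerSeries.mk fun k => ((k : ℚ) + 1) ^ (k - 1) / (Nat.factorial k)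

theorem treeT_eq : treeT = PowerSeries.X * treeE := by
  ext n
  cases n with
  | zero => simp [treeT]
  | succ n =>
    rw [mul_comm, PowerSeries.coeff_succ_mul_X]
    simp only [treeT, treeE, PowerSeries.coeff_mk, Nat.succ_ne_zero, if_false]
    cases n with
    | zero => simp
    | succ n =>
      rw [Nat.factorial_succ (n + 1)]
      simp only [Nat.add_sub_cancel]
      push_cast
      have : ((n : ℚ) + 1 + 1) ≠ 0 := by positivity
      field_simp
      ring

theorem deriv_treeT : PowerSeries.derivative ℚ treeT =
    (1 + PowerSeries.X * PowerSeries.derivative ℚ treeT) * treeE := by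
  have hB : (1 + PowerSeries.X * PowerSeries.derivative ℚ treeT) =
      PowerSeries.mk fun k => (k : ℚ) ^ k / (Nat.factorial k) := by
    ext n
    cases n with
    | zero => simp
    | succ n =>
      rw [map_add, mul_comm, PowerSeries.coeff_succ_mul_X, PowerSeries.coeff_derivative]
      simp [treeT, PowerSeries.coeff_one]
      ring
  rw [hB]
  ext n
  rw [mul_comm, PowerSeries.coeff_mul,
    Finset.Nat.sum_antidiagonal_eq_sum_range_succ
      (fun i j => PowerSeries.coeff i treeE *
        PowerSeries.coeff j (PowerSeries.mk fun k => (k : ℚ) ^ k / (Nat.factorial k))),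
    PowerSeries.coeff_derivative]
  have h := congrArg (Polynomial.eval (n : ℚ)) (abel_poly n)
  simp only [Polynomial.eval_finsetSum, Polynomial.eval_mul,
        Polynomial.eval_C, Polynomial.eval_pow, Polynomial.eval_X, Polynomial.eval_add,
        Polynomial.eval_one, Polynomial.eval_sub] at h
  have hn : (Nat.factorial n : ℚ) ≠ 0 := by positivity
  have hl : PowerSeries.coeff (n + 1) treeT * ((n : ℚ) + 1) =
      ((n : ℚ) + 1) ^ n / Nat.factorial n := by
    simp only [treeT, PowerSeries.coeff_mk, Nat.succ_ne_zero, if_false, Nat.add_sub_cancel,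
      Nat.factorial_succ]
    push_cast
    have : ((n : ℚ) + 1) ≠ 0 := by positivity
    field_simp
  rw [hl, ← h, Finset.sum_div]
  refine Finset.sum_congr rfl fun k hk => ?_
  have hk' : k ≤ n := Nat.lt_succ_iff.mp (Finset.mem_range.mp hk)
  simp only [treeE, PowerSeries.coeff_mk]
  rw [Nat.cast_choose ℚ hk', Nat.cast_sub hk']
  have h1 : (Nat.factorial k : ℚ) ≠ 0 := by positivity
  have h2 : (Nat.factorial (n - k) : ℚ) ≠ 0 := by positivity
  field_simp

theorem deriv_treeE : PowerSeries.derivative ℚ treeE =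
    PowerSeries.derivative ℚ treeT * treeE := by
  have h1 := deriv_treeT
  have h2 : PowerSeries.derivative ℚ treeT =
      treeE + PowerSeries.X * PowerSeries.derivative ℚ treeE := by
    conv_lhs => rw [treeT_eq]
    rw [Derivation.leibniz, PowerSeries.derivative_X]
    simp only [smul_eq_mul]
    ring
  apply mul_left_cancel₀ (PowerSeries.X_ne_zero (R := ℚ))
  linear_combination h1 - h2

theorem expPS_eq (S : PowerSeries ℚ) (hS : PowerSeries.constantCoeff S = 0) :
    expPS S = (PowerSeries.exp ℚ).subst S := by
  ext d
  rw [PowerSeries.coeff_subst' (PowerSeries.HasSubst.of_constantCoeff_zero' hS),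
    finsum_eq_sum_of_support_subset (s := Finset.range (d + 1))]
  · simp only [expPS, PowerSeries.coeff_mk, PowerSeries.coeff_exp]
    refine Finset.sum_congr rfl fun k _ => ?_
    simp
    ring
  · intro k hk
    by_contra hkd
    apply hk
    simp only [Finset.coe_range, Set.mem_Iio, not_lt] at hkd
    have : PowerSeries.coeff d (S ^ k) = 0 := by
      have hX : (PowerSeries.X : PowerSeries ℚ) ^ k ∣ S ^ k :=
        pow_dvd_pow_of_dvd (PowerSeries.X_dvd_iff.mpr hS) k
      exact PowerSeries.X_pow_dvd_iff.mp hX d (by omega)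
    simp [this]

theorem deriv_expPS (S : PowerSeries ℚ) (hS : PowerSeries.constantCoeff S = 0) :
    PowerSeries.derivative ℚ (expPS S) = PowerSeries.derivative ℚ S * expPS S := by
  rw [expPS_eq S hS, PowerSeries.derivative_subst (PowerSeries.HasSubst.of_constantCoeff_zero' hS),
    PowerSeries.derivative_exp, mul_comm]

theorem const_expPS (S : PowerSeries ℚ) : PowerSeries.constantCoeff (expPS S) = 1 := by
  rw [← PowerSeries.coeff_zero_eq_constantCoeff_apply]
  simp [expPS]

theorem ode_unique (A F H : PowerSeries ℚ) (hF : PowerSeries.derivative ℚ F = A * F)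
    (hH : PowerSeries.derivative ℚ H = A * H) (cF : PowerSeries.constantCoeff F = 1)
    (cH : PowerSeries.constantCoeff H = 1) : F = H := by
  have hne : PowerSeries.constantCoeff H ≠ 0 := by rw [cH]; exact one_ne_zero
  have hi := PowerSeries.mul_inv_cancel H hne
  have : F * H⁻¹ = 1 := by
    apply PowerSeries.derivative.ext
    · rw [Derivation.leibniz, PowerSeries.derivative_inv', hF, hH, PowerSeries.derivative_one]
      simp only [smul_eq_mul]
      linear_combination (- F * A * H⁻¹) * hi
    · simp [cF, cH]
  calc F = F * H⁻¹ * H := by rw [mul_assoc, mul_comm H⁻¹, hi, mul_one]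
    _ = H := by rw [this, one_mul]

theorem const_treeT : PowerSeries.constantCoeff treeT = 0 := by
  rw [treeT_eq]; simp

theorem const_smul_treeT (n : ℕ) : PowerSeries.constantCoeff (n • treeT) = 0 := by
  rw [map_nsmul, const_treeT, smul_zero]

theorem treeE_eq : treeE = expPS treeT := by
  refine ode_unique _ _ _ deriv_treeE (deriv_expPS _ const_treeT) ?_ (const_expPS _)
  rw [← PowerSeries.coeff_zero_eq_constantCoeff_apply]
  simp [treeE]

theorem expPS_succ (n : ℕ) : expPS ((n + 1) • treeT) = expPS (n • treeT) * treeE := by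
  refine ode_unique _ _ _ (deriv_expPS _ (const_smul_treeT _)) ?_ (const_expPS _) ?_
  · rw [Derivation.leibniz, deriv_expPS _ (const_smul_treeT _), deriv_treeE, add_smul, one_smul,
      map_add]
    simp only [smul_eq_mul]
    ring
  · rw [map_mul, const_expPS, treeE_eq, const_expPS, mul_one]

theorem inv_one_sub : (1 - treeT) * (1 - treeT)⁻¹ = 1 := by
  apply PowerSeries.mul_inv_cancel
  simp [const_treeT]

theorem deriv_treeT' : PowerSeries.derivative ℚ treeT = treeE * (1 - treeT)⁻¹ := by
  have h := deriv_treeT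
  have h' := treeT_eq
  linear_combination (-PowerSeries.derivative ℚ treeT) * inv_one_sub + (1 - treeT)⁻¹ * h -
    (1 - treeT)⁻¹ * PowerSeries.derivative ℚ treeT * h'

theorem deriv_inv_tree : PowerSeries.derivative ℚ (1 - treeT)⁻¹ =
    ((1 - treeT)⁻¹) ^ 2 * PowerSeries.derivative ℚ treeT := by
  rw [PowerSeries.derivative_inv', map_sub, PowerSeries.derivative_one]
  ring

theorem stmt_1 (G : ℕ → Polynomial ℚ) (hG1 : G 1 = 1)
    (hGrec : ∀ n : ℕ, 1 ≤ n → G (n + 1) =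
      (Polynomial.C (2 * (n : ℚ)) + Polynomial.C (n : ℚ) * Polynomial.X) * G n
        + (1 + Polynomial.X) ^ 2 * Polynomial.derivative (G n)) :
    ∀ n : ℕ, 1 ≤ n →
      (PowerSeries.derivativeFun (R := ℚ))^[n] treeT =
        expPS (n • treeT) * ((1 - treeT)⁻¹) ^ n *
          Polynomial.aeval (treeT * (1 - treeT)⁻¹) (G n) := by
  intro n hn
  induction n, hn using Nat.le_induction with
  | base =>
    rw [hG1, Function.iterate_one, one_smul, ← treeE_eq, map_one, mul_one, pow_one]
    exact deriv_treeT'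
  | succ n hn ih =>
    rw [Function.iterate_succ_apply', ih, hGrec n hn, expPS_succ]
    change PowerSeries.derivative ℚ _ = _
    have hI := inv_one_sub
    have hT := deriv_treeT'
    have hDI := deriv_inv_tree
    have hDE := deriv_expPS _ (const_smul_treeT n)
    rw [map_nsmul, nsmul_eq_mul n (PowerSeries.derivative ℚ treeT)] at hDE
    obtain ⟨m, rfl⟩ : ∃ m, n = m + 1 := ⟨n - 1, by omega⟩
    rw [Derivation.leibniz, Derivation.leibniz, PowerSeries.derivative_pow, Derivation.map_aeval,
      Derivation.leibniz, hDE, hDI, hT]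
    have hx : treeT * (1 - treeT)⁻¹ = (1 - treeT)⁻¹ - 1 := by linear_combination -hI
    simp only [map_add, map_mul, map_pow, map_one, Polynomial.aeval_X, Polynomial.aeval_C,
      smul_eq_mul, Nat.add_sub_cancel]
    rw [hx]
    generalize Polynomial.aeval ((1 - treeT)⁻¹ - 1) (G (m + 1)) = g
    generalize Polynomial.aeval ((1 - treeT)⁻¹ - 1) (Polynomial.derivative (G (m + 1))) = g'
    generalize expPS ((m + 1) • treeT) = e
    have hx' : treeT * (1 - treeT)⁻¹ ^ 2 = (1 - treeT)⁻¹ ^ 2 - (1 - treeT)⁻¹ := by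
      linear_combination (1 - treeT)⁻¹ * hx
    generalize (1 - treeT)⁻¹ = I at *
    simp only [map_natCast, map_ofNat]
    push_cast
    linear_combination (e * I ^ (m + 1) * g' * treeE * I) * hx'
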